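/- For any real numbers φ and α satisfying π/6 < φ < 2π/3 and α = φ − π/6, there exists a 3-special polygon P with angle parameters φ(P) = φ and α(P) = α; moreover, if P₁ is any other 3-special polygon with φ(P₁) = φ and α(P₁) = α, then P₁ is directly similar to P. -/

import Mathlib

open Real EuclideanGeometry

attribute [local instance] Complex.finrank_real_complex_fact

/-- The signed turning angle at the middle vertex `q` of the path `p → q → r`:
the oriented angle from the direction `q - p` to the direction `r - q`,
taken in `(-π, π]`. -/
noncomputable def turn (p q r : ℂ) : ℝ :=
  (Complex.orientation.oangle (q - p) (r - q)).toReal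

/-- A cyclic sequence of vertices in the plane bounds a simple polygon:
all edges are nondegenerate, consecutive edges meet exactly in their shared
vertex, and non-adjacent edges are disjoint. -/
def IsSimplePolygon {n : ℕ} [NeZero n] (v : Fin n → ℂ) : Prop :=
  (∀ i, v i ≠ v (i + 1)) ∧
  (∀ i : Fin n, segment ℝ (v i) (v (i + 1)) ∩ segment ℝ (v (i + 1)) (v (i + 2)) = {v (i + 1)}) ∧
  (∀ i j : Fin n, j ≠ i → j ≠ i + 1 → j + 1 ≠ i →
    segment ℝ (v i) (v (i + 1)) ∩ segment ℝ (v j) (v (j + 1)) = ∅)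

/-- A simple polygon is positively (counterclockwisely) oriented when the sum
of its signed turning angles is `2π`. -/
def IsCCW {n : ℕ} [NeZero n] (v : Fin n → ℂ) : Prop :=
  ∑ i : Fin n, turn (v (i - 1)) (v i) (v (i + 1)) = 2 * π

/-- The interior angle of a counterclockwisely ordered simple polygon at its
`i`-th vertex: `π` minus the signed turning angle there.  It may exceed `π`
(at reflex vertices). -/
noncomputable def intAngle {n : ℕ} [NeZero n] (v : Fin n → ℂ) (i : Fin n) : ℝ :=
  π - turn (v (i - 1)) (v i) (v (i + 1))

/-- A 2-special polygon: a simple quadrilateral with counterclockwise vertices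
`a, c', d, c''` whose interior angle at `a` is `4π/3`, whose interior angles at
`c'` and `c''` are less than `π`, whose interior angle at `d` is `π/3`, and with
`c'`, `d`, `c''` equidistant from `a`. -/
def Is2Special (a c' d c'' : ℂ) : Prop :=
  IsSimplePolygon ![a, c', d, c''] ∧ IsCCW ![a, c', d, c''] ∧
  intAngle ![a, c', d, c''] 0 = 4 * π / 3 ∧
  intAngle ![a, c', d, c''] 1 < π ∧
  intAngle ![a, c', d, c''] 3 < π ∧
  intAngle ![a, c', d, c''] 2 = π / 3 ∧
  dist a c' = dist a d ∧ dist a d = dist a c''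

/-- A 3-special polygon: a simple pentagon with counterclockwise vertices
`a, c', e', e'', c''` whose interior angle at `a` is `4π/3`, all other interior
angles being less than `π`, with interior angles `π/3` at `c'` and `c''`,
`dist a c' = dist a c''`, sides `c'e'` and `c''e''` parallel and of equal
length, and interior angles `π/2` at `e'` and `e''`. -/
def Is3Special (a c' e' e'' c'' : ℂ) : Prop :=
  IsSimplePolygon ![a, c', e', e'', c''] ∧ IsCCW ![a, c', e', e'', c''] ∧
  intAngle ![a, c', e', e'', c''] 0 = 4 * π / 3 ∧
  (∀ i : Fin 5, i ≠ 0 → intAngle ![a, c', e', e'', c''] i < π) ∧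
  intAngle ![a, c', e', e'', c''] 1 = π / 3 ∧
  intAngle ![a, c', e', e'', c''] 4 = π / 3 ∧
  dist a c' = dist a c'' ∧
  (∃ r : ℝ, e'' - c'' = r • (e' - c')) ∧
  dist c' e' = dist c'' e'' ∧
  intAngle ![a, c', e', e'', c''] 2 = π / 2 ∧
  intAngle ![a, c', e', e'', c''] 3 = π / 2

/-- A 4-special polygon: a simple hexagon with counterclockwise vertices
`a, c', e', f', e'', c''` whose interior angle at `a` is `4π/3`, all other
interior angles being less than `π`, with interior angles `π/3` at `c'` and
`c''`, `dist a c' = dist a c''`, sides `c'e'` and `c''e''` parallel and of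
equal length, and `e'`, `f'`, `e''` equidistant from `a`. -/
def Is4Special (a c' e' f' e'' c'' : ℂ) : Prop :=
  IsSimplePolygon ![a, c', e', f', e'', c''] ∧ IsCCW ![a, c', e', f', e'', c''] ∧
  intAngle ![a, c', e', f', e'', c''] 0 = 4 * π / 3 ∧
  (∀ i : Fin 6, i ≠ 0 → intAngle ![a, c', e', f', e'', c''] i < π) ∧
  intAngle ![a, c', e', f', e'', c''] 1 = π / 3 ∧
  intAngle ![a, c', e', f', e'', c''] 5 = π / 3 ∧
  dist a c' = dist a c'' ∧
  (∃ r : ℝ, e'' - c'' = r • (e' - c')) ∧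
  dist c' e' = dist c'' e'' ∧
  dist a e' = dist a f' ∧ dist a f' = dist a e''

/-- The unit complex number with argument `θ`. -/
noncomputable def unitC (θ : ℝ) : ℂ := ⟨Real.cos θ, Real.sin θ⟩

lemma turn_eq_arg (p q r : ℂ) :
    turn p q r = Complex.arg ((starRingEnd ℂ) (q - p) * (r - q)) := by
  unfold turn
  rw [Complex.oangle, Complex.arg_coe_angle_toReal_eq_arg]

lemma unitC_eq (θ : ℝ) : unitC θ = Complex.cos θ + Complex.sin θ * Complex.I := by
  apply Complex.ext <;> simp [unitC, Complex.cos_ofReal_re, Complex.sin_ofReal_re]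

lemma turn_of {p q r : ℂ} {ρ θ : ℝ} (hρ : 0 < ρ) (h1 : -π < θ) (h2 : θ ≤ π)
    (hpq : q - p ≠ 0) (h : r - q = ρ * unitC θ * (q - p)) : turn p q r = θ := by
  rw [turn_eq_arg, h]
  have hn : 0 < Complex.normSq (q - p) := Complex.normSq_pos.2 hpq
  have : (starRingEnd ℂ) (q - p) * (ρ * unitC θ * (q - p))
      = ((Complex.normSq (q - p) * ρ : ℝ) : ℂ) * (Complex.cos θ + Complex.sin θ * Complex.I) := by
    rw [← unitC_eq, Complex.ofReal_mul, Complex.normSq_eq_conj_mul_self]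
    ring
  rw [this]
  exact Complex.arg_mul_cos_add_sin_mul_I (by positivity) ⟨h1, h2⟩

lemma turn_of' {p q r : ℂ} {ρ θ : ℝ} (hρ : 0 < ρ) (h1 : -π < θ) (h2 : θ ≤ π)
    (hpq : q - p ≠ 0)
    (h3 : r.re - q.re = ρ * (Real.cos θ * (q.re - p.re) - Real.sin θ * (q.im - p.im)))
    (h4 : r.im - q.im = ρ * (Real.cos θ * (q.im - p.im) + Real.sin θ * (q.re - p.re))) :
    turn p q r = θ := by
  refine turn_of hρ h1 h2 hpq ?_
  rw [mul_assoc]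
  apply Complex.ext
  · rw [Complex.re_ofReal_mul]
    simpa [unitC] using h3
  · rw [Complex.im_ofReal_mul]
    simpa [unitC] using h4

lemma turn_inv {p q r : ℂ} {θ : ℝ} (h : turn p q r = θ) (hθ : θ ≠ 0) :
    q - p ≠ 0 ∧ ∃ ρ : ℝ, 0 < ρ ∧ r - q = ρ * unitC θ * (q - p) := by
  rw [turn_eq_arg] at h
  set z := (starRingEnd ℂ) (q - p) * (r - q) with hz
  have hz0 : z ≠ 0 := by
    rintro h0
    rw [h0, Complex.arg_zero] at h
    exact hθ h.symm
  have hqp : q - p ≠ 0 := by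
    intro h0
    apply hz0
    rw [hz, h0]
    simp
  refine ⟨hqp, ‖z‖ / Complex.normSq (q - p), ?_, ?_⟩
  · exact div_pos (norm_pos_iff.2 hz0) (Complex.normSq_pos.2 hqp)
  · have h3 := Complex.norm_mul_cos_add_sin_mul_I z
    rw [h, ← unitC_eq] at h3
    have hc : (starRingEnd ℂ) (q - p) ≠ 0 := (map_ne_zero _).2 hqp
    rw [Complex.ofReal_div, Complex.normSq_eq_conj_mul_self]
    field_simp
    rw [h3, hz]
    ring

lemma angle_of {x y : ℂ} {ρ θ : ℝ} (hρ : 0 < ρ) (h1 : 0 ≤ θ) (h2 : θ ≤ π)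
    (hx : x ≠ 0) (h : y = ρ * unitC θ * x) : InnerProductGeometry.angle y x = θ := by
  have hu : unitC θ ≠ 0 := by
    intro h0
    have := Real.sin_sq_add_cos_sq θ
    have e1 : Real.cos θ = 0 := congrArg Complex.re h0
    have e2 : Real.sin θ = 0 := congrArg Complex.im h0
    rw [e1, e2] at this
    norm_num at this
  have hρ' : (ρ : ℂ) ≠ 0 := by exact_mod_cast hρ.ne'
  have hy : y ≠ 0 := by
    rw [h]
    exact mul_ne_zero (mul_ne_zero hρ' hu) hx
  rw [Complex.angle_eq_abs_arg hy hx, h, mul_div_cancel_right₀ _ hx, unitC_eq,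
    Complex.arg_mul_cos_add_sin_mul_I hρ ⟨by linarith [Real.pi_pos], h2⟩, abs_of_nonneg h1]

lemma angle_inv {x z : ℂ} {θ : ℝ} (hx : x ≠ 0) (hz : 0 < z.im)
    (h : InnerProductGeometry.angle x (z * x) = θ) :
    z.re * Real.sin θ = z.im * Real.cos θ := by
  have hz0 : z ≠ 0 := by
    rintro rfl
    simp at hz
  rw [InnerProductGeometry.angle_comm, Complex.angle_eq_abs_arg (mul_ne_zero hz0 hx) hx,
    mul_div_cancel_right₀ _ hx, abs_of_nonneg (Complex.arg_nonneg_iff.2 hz.le)] at h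
  have h1 := Complex.norm_mul_cos_arg z
  have h2 := Complex.norm_mul_sin_arg z
  rw [h] at h1 h2
  rw [← h1, ← h2]
  ring

lemma seg_le (f : ℂ →ₗ[ℝ] ℝ) {p q x : ℂ} {m : ℝ} (hp : f p ≤ m) (hq : f q ≤ m)
    (hx : x ∈ segment ℝ p q) : f x ≤ m := by
  obtain ⟨a, b, ha, hb, hab, rfl⟩ := hx
  simp only [map_add, map_smul, smul_eq_mul]
  have h1 := mul_le_mul_of_nonneg_left hp ha
  have h2 := mul_le_mul_of_nonneg_left hq hb
  have h3 : a * m + b * m = m := by rw [← add_mul, hab, one_mul]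
  linarith

lemma seg_disj (f : ℂ →ₗ[ℝ] ℝ) (m n : ℝ) {p q r s : ℂ} (hmn : m < n)
    (hp : f p ≤ m) (hq : f q ≤ m) (hr : n ≤ f r) (hs : n ≤ f s) :
    segment ℝ p q ∩ segment ℝ r s = ∅ := by
  ext x
  simp only [Set.mem_inter_iff, Set.mem_empty_iff_false, iff_false]
  rintro ⟨h1, h2⟩
  have a1 := seg_le f hp hq h1
  have a2 := seg_le (-f) (m := -n) (by simpa using hr) (by simpa using hs) h2
  simp at a2
  linarith

lemma seg_meet (f : ℂ →ₗ[ℝ] ℝ) {p q r : ℂ} (hp : f p < f q) (hr : f q ≤ f r) :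
    segment ℝ p q ∩ segment ℝ q r = {q} := by
  ext x
  simp only [Set.mem_inter_iff, Set.mem_singleton_iff]
  constructor
  · rintro ⟨h1, h2⟩
    have a2 := seg_le (-f) (m := -f q) (by simp) (by simpa using hr) h2
    simp at a2
    obtain ⟨a, b, ha, hb, hab, rfl⟩ := h1
    simp only [map_add, map_smul, smul_eq_mul] at a2
    have : a = 0 := by
      by_contra h0
      have : 0 < a := lt_of_le_of_ne ha (Ne.symm h0)
      have : b = 1 - a := by linarith
      subst this
      nlinarith
    subst this
    have : b = 1 := by linarith
    subst this
    simp
  · rintro rfl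
    exact ⟨right_mem_segment _ _ _, left_mem_segment _ _ _⟩

lemma seg_meet' (f : ℂ →ₗ[ℝ] ℝ) {p q r : ℂ} (hp : f p ≤ f q) (hr : f q < f r) :
    segment ℝ p q ∩ segment ℝ q r = {q} := by
  rw [Set.inter_comm, segment_symm ℝ q r, segment_symm ℝ p q]
  exact seg_meet (-f) (by simpa using hr) (by simpa using hp)

lemma model_simple {s k : ℝ} (hs : 0 < s) (hk : 1 < k) :
    IsSimplePolygon ![(⟨0, 0⟩ : ℂ), ⟨-s, 1⟩, ⟨-s, 1 - k⟩, ⟨s, 1 - k⟩, ⟨s, 1⟩] := by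
  have d1 : segment ℝ (⟨0, 0⟩ : ℂ) ⟨-s, 1⟩ ∩ segment ℝ ⟨-s, 1 - k⟩ ⟨s, 1 - k⟩ = ∅ := by
    apply seg_disj (-Complex.imLm) 0 (k - 1) <;> simp <;> linarith
  have d2 : segment ℝ (⟨0, 0⟩ : ℂ) ⟨-s, 1⟩ ∩ segment ℝ ⟨s, 1 - k⟩ ⟨s, 1⟩ = ∅ := by
    apply seg_disj (Complex.reLm) 0 s <;> (try simp) <;> linarith
  have d3 : segment ℝ (⟨-s, 1⟩ : ℂ) ⟨-s, 1 - k⟩ ∩ segment ℝ ⟨s, 1 - k⟩ ⟨s, 1⟩ = ∅ := by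
    apply seg_disj (Complex.reLm) 0 s <;> (try simp) <;> linarith
  have d4 : segment ℝ (⟨-s, 1⟩ : ℂ) ⟨-s, 1 - k⟩ ∩ segment ℝ ⟨s, 1⟩ ⟨0, 0⟩ = ∅ := by
    apply seg_disj (Complex.reLm) (-s) 0 <;> simp <;> linarith
  have d5 : segment ℝ (⟨-s, 1 - k⟩ : ℂ) ⟨s, 1 - k⟩ ∩ segment ℝ ⟨s, 1⟩ ⟨0, 0⟩ = ∅ := by
    apply seg_disj (Complex.imLm) (1 - k) 0 <;> simp <;> linarith
  refine ⟨?_, ?_, ?_⟩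
  · intro i
    fin_cases i
    · intro h
      have := congrArg Complex.im h
      simp at this
    · intro h
      have := congrArg Complex.im h
      simp at this
      linarith
    · intro h
      have := congrArg Complex.re h
      simp at this
      linarith
    · intro h
      have := congrArg Complex.im h
      simp at this
      linarith
    · intro h
      have := congrArg Complex.im h
      simp at this
  · intro i
    fin_cases i
    · show segment ℝ (⟨0, 0⟩ : ℂ) ⟨-s, 1⟩ ∩ segment ℝ ⟨-s, 1⟩ ⟨-s, 1 - k⟩ = {⟨-s, 1⟩}
      apply seg_meet (-Complex.reLm) <;> simp <;> linarith
    · show segment ℝ (⟨-s, 1⟩ : ℂ) ⟨-s, 1 - k⟩ ∩ segment ℝ ⟨-s, 1 - k⟩ ⟨s, 1 - k⟩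
        = {⟨-s, 1 - k⟩}
      apply seg_meet (-Complex.imLm) <;> simp <;> linarith
    · show segment ℝ (⟨-s, 1 - k⟩ : ℂ) ⟨s, 1 - k⟩ ∩ segment ℝ ⟨s, 1 - k⟩ ⟨s, 1⟩
        = {⟨s, 1 - k⟩}
      apply seg_meet' (Complex.imLm) <;> simp <;> linarith
    · show segment ℝ (⟨s, 1 - k⟩ : ℂ) ⟨s, 1⟩ ∩ segment ℝ ⟨s, 1⟩ ⟨0, 0⟩ = {⟨s, 1⟩}
      apply seg_meet' (-Complex.reLm) <;> simp <;> linarith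
    · show segment ℝ (⟨s, 1⟩ : ℂ) ⟨0, 0⟩ ∩ segment ℝ ⟨0, 0⟩ ⟨-s, 1⟩ = {⟨0, 0⟩}
      apply seg_meet (-Complex.reLm) <;> simp <;> linarith
  · intro i j h1 h2 h3
    fin_cases i <;> fin_cases j <;>
      first
      | exact absurd rfl h1
      | exact absurd rfl h2
      | exact absurd rfl h3
      | exact d1
      | exact d2
      | exact d3
      | exact d4
      | exact d5
      | (rw [Set.inter_comm]; exact d1)
      | (rw [Set.inter_comm]; exact d2)
      | (rw [Set.inter_comm]; exact d3)
      | (rw [Set.inter_comm]; exact d4)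
      | (rw [Set.inter_comm]; exact d5)

lemma cos_two_pi_div_three' : Real.cos (2 * π / 3) = -(1 / 2) := by
  rw [show 2 * π / 3 = π - π / 3 by ring, Real.cos_pi_sub, Real.cos_pi_div_three]

lemma sin_two_pi_div_three' : Real.sin (2 * π / 3) = √3 / 2 := by
  rw [show 2 * π / 3 = π - π / 3 by ring, Real.sin_pi_sub, Real.sin_pi_div_three]

lemma model_special {k : ℝ} (hk : 1 < k) :
    Is3Special ⟨0, 0⟩ ⟨-√3, 1⟩ ⟨-√3, 1 - k⟩ ⟨√3, 1 - k⟩ ⟨√3, 1⟩ := by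
  have hs : 0 < √3 := by positivity
  have hs2 : √3 * √3 = 3 := Real.mul_self_sqrt (by norm_num)
  have hk0 : 0 < k := by linarith
  have hpi := Real.pi_pos
  have t0 : turn ⟨√3, 1⟩ ⟨0, 0⟩ ⟨-√3, 1⟩ = -(π / 3) := by
    apply turn_of' (ρ := 1) one_pos (by linarith) (by linarith)
    · intro h
      have := congrArg Complex.im h
      simp at this
    · simp
      ring
    · simp
      nlinarith
  have t1 : turn ⟨0, 0⟩ ⟨-√3, 1⟩ ⟨-√3, 1 - k⟩ = 2 * π / 3 := by
    apply turn_of' (ρ := k / 2) (by linarith) (by linarith) (by linarith)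
    · intro h
      have := congrArg Complex.im h
      simp at this
    · simp [cos_two_pi_div_three', sin_two_pi_div_three']
      ring_nf
      simp
    · simp [cos_two_pi_div_three', sin_two_pi_div_three']
      linear_combination (k / 4) * hs2
  have t2 : turn ⟨-√3, 1⟩ ⟨-√3, 1 - k⟩ ⟨√3, 1 - k⟩ = π / 2 := by
    apply turn_of' (ρ := 2 * √3 / k) (by positivity) (by linarith) (by linarith)
    · intro h
      have := congrArg Complex.im h
      simp at this
      linarith
    · simp
      try (field_simp; ring)
    · simp
      try (field_simp; ring)
  have t3 : turn ⟨-√3, 1 - k⟩ ⟨√3, 1 - k⟩ ⟨√3, 1⟩ = π / 2 := by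
    apply turn_of' (ρ := k / (2 * √3)) (by positivity) (by linarith) (by linarith)
    · intro h
      have := congrArg Complex.re h
      simp at this
    · simp
      try (field_simp; ring)
    · simp
      try (field_simp; ring)
  have t4 : turn ⟨√3, 1 - k⟩ ⟨√3, 1⟩ ⟨0, 0⟩ = 2 * π / 3 := by
    apply turn_of' (ρ := 2 / k) (by positivity) (by linarith) (by linarith)
    · intro h
      have := congrArg Complex.im h
      simp at this
      linarith
    · simp [cos_two_pi_div_three', sin_two_pi_div_three']
      try field_simp
    · simp [cos_two_pi_div_three', sin_two_pi_div_three']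
      try field_simp
  have i0 : intAngle ![(⟨0, 0⟩ : ℂ), ⟨-√3, 1⟩, ⟨-√3, 1 - k⟩, ⟨√3, 1 - k⟩, ⟨√3, 1⟩] 0
      = 4 * π / 3 := by
    show π - turn ⟨√3, 1⟩ ⟨0, 0⟩ ⟨-√3, 1⟩ = _
    rw [t0]
    ring
  have i1 : intAngle ![(⟨0, 0⟩ : ℂ), ⟨-√3, 1⟩, ⟨-√3, 1 - k⟩, ⟨√3, 1 - k⟩, ⟨√3, 1⟩] 1
      = π / 3 := by
    show π - turn ⟨0, 0⟩ ⟨-√3, 1⟩ ⟨-√3, 1 - k⟩ = _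
    rw [t1]
    ring
  have i2 : intAngle ![(⟨0, 0⟩ : ℂ), ⟨-√3, 1⟩, ⟨-√3, 1 - k⟩, ⟨√3, 1 - k⟩, ⟨√3, 1⟩] 2
      = π / 2 := by
    show π - turn ⟨-√3, 1⟩ ⟨-√3, 1 - k⟩ ⟨√3, 1 - k⟩ = _
    rw [t2]
    ring
  have i3 : intAngle ![(⟨0, 0⟩ : ℂ), ⟨-√3, 1⟩, ⟨-√3, 1 - k⟩, ⟨√3, 1 - k⟩, ⟨√3, 1⟩] 3
      = π / 2 := by
    show π - turn ⟨-√3, 1 - k⟩ ⟨√3, 1 - k⟩ ⟨√3, 1⟩ = _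
    rw [t3]
    ring
  have i4 : intAngle ![(⟨0, 0⟩ : ℂ), ⟨-√3, 1⟩, ⟨-√3, 1 - k⟩, ⟨√3, 1 - k⟩, ⟨√3, 1⟩] 4
      = π / 3 := by
    show π - turn ⟨√3, 1 - k⟩ ⟨√3, 1⟩ ⟨0, 0⟩ = _
    rw [t4]
    ring
  refine ⟨model_simple hs hk, ?_, i0, ?_, i1, i4, ?_, ⟨1, ?_⟩, ?_, i2, i3⟩
  · unfold IsCCW
    rw [Fin.sum_univ_five]
    show turn ⟨√3, 1⟩ ⟨0, 0⟩ ⟨-√3, 1⟩ + turn ⟨0, 0⟩ ⟨-√3, 1⟩ ⟨-√3, 1 - k⟩ +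
      turn ⟨-√3, 1⟩ ⟨-√3, 1 - k⟩ ⟨√3, 1 - k⟩ + turn ⟨-√3, 1 - k⟩ ⟨√3, 1 - k⟩ ⟨√3, 1⟩ +
      turn ⟨√3, 1 - k⟩ ⟨√3, 1⟩ ⟨0, 0⟩ = _
    rw [t0, t1, t2, t3, t4]
    ring
  · intro i hi
    fin_cases i
    · exact absurd rfl hi
    · exact i1.trans_lt (by linarith)
    · exact i2.trans_lt (by linarith)
    · exact i3.trans_lt (by linarith)
    · exact i4.trans_lt (by linarith)
  · simp [Complex.dist_eq_re_im]
  · apply Complex.ext <;> simp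
  · simp [Complex.dist_eq_re_im]

/-- Every 3-special polygon is determined by one positive parameter and the first edge vector. -/
lemma special_shape {a c' e' e'' c'' : ℂ} (h : Is3Special a c' e' e'' c'') :
    c' - a ≠ 0 ∧ ∃ ρ : ℝ, 0 < ρ ∧
      e' = a + (1 + ρ * unitC (2 * π / 3)) * (c' - a) ∧
      e'' = a + (1 + ρ * unitC (2 * π / 3) + √3 * Complex.I * unitC (2 * π / 3)) * (c' - a) ∧
      c'' = a - unitC (π / 3) * (c' - a) := by
  obtain ⟨-, -, g0, -, g1, -, hd, -, -, g2, g3⟩ := h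
  have hpi := Real.pi_pos
  have hs : 0 < √3 := by positivity
  have hs2 : √3 * √3 = 3 := Real.mul_self_sqrt (by norm_num)
  change π - turn c'' a c' = _ at g0
  change π - turn a c' e' = _ at g1
  change π - turn c' e' e'' = _ at g2
  change π - turn e' e'' c'' = _ at g3
  obtain ⟨n0, r0, p0, q0⟩ := turn_inv (θ := -(π / 3)) (p := c'') (q := a) (r := c') (by linarith) (by linarith)
  obtain ⟨n1, r1, p1, q1⟩ := turn_inv (θ := 2 * π / 3) (p := a) (q := c') (r := e')
    (by linarith) (by linarith)
  obtain ⟨n2, r2, p2, q2⟩ := turn_inv (θ := π / 2) (p := c') (q := e') (r := e'')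
    (by linarith) (by linarith)
  obtain ⟨n3, r3, p3, q3⟩ := turn_inv (θ := π / 2) (p := e') (q := e'') (r := c'')
    (by linarith) (by linarith)
  have hr0 : r0 = 1 := by
    have hn : ‖c' - a‖ = r0 * ‖a - c''‖ := by
      rw [q0, norm_mul, norm_mul, unitC_eq, Complex.norm_cos_add_sin_mul_I,
        Complex.norm_of_nonneg p0.le, mul_one]
    rw [dist_comm, dist_eq_norm, dist_eq_norm] at hd
    rw [hd] at hn
    have : 0 < ‖a - c''‖ := norm_pos_iff.2 n0
    nlinarith
  have E1 : unitC (π / 3) * unitC (-(π / 3)) = 1 := by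
    apply Complex.ext <;> simp [unitC] <;> nlinarith
  have E2 : unitC (π / 2) = Complex.I := by
    apply Complex.ext <;> simp [unitC]
  rw [hr0, Complex.ofReal_one, one_mul] at q0
  rw [E2] at q2 q3
  have hc'' : c'' = a - unitC (π / 3) * (c' - a) := by
    rw [q0, ← mul_assoc, E1]
    ring
  have key : (1 + r1 * unitC (2 * π / 3) + (r2 * r1 : ℝ) * Complex.I * unitC (2 * π / 3)
      - (r3 * r2 * r1 : ℝ) * unitC (2 * π / 3) + unitC (π / 3)) * (c' - a) = 0 := by
    push_cast
    linear_combination hc'' - q3 - (1 + r3 * Complex.I) * q2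
      - (1 + r2 * Complex.I + r3 * r2 * Complex.I * Complex.I) * q1
      - r3 * r2 * r1 * unitC (2 * π / 3) * (c' - a) * Complex.I_mul_I
  have key2 := (mul_eq_zero.1 key).resolve_right n1
  have k1 := congrArg Complex.re key2
  have k2 := congrArg Complex.im key2
  simp [unitC, cos_two_pi_div_three', sin_two_pi_div_three', -Complex.ofReal_mul] at k1 k2
  have hx : r1 - r3 * r2 * r1 = 0 := by
    have := congrArg (√3 * ·) k2
    ring_nf at this k1
    have hs3 : √3 ^ 2 = 3 := by rw [sq, hs2]
    rw [hs3] at this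
    linarith
  have hy : r2 * r1 = √3 := by
    have : (√3 / 2) * (r1 - r3 * r2 * r1) = 0 := by rw [hx, mul_zero]
    linarith
  have he' : e' = a + (1 + r1 * unitC (2 * π / 3)) * (c' - a) := by
    linear_combination q1
  refine ⟨n1, r1, p1, he', ?_, hc''⟩
  rw [← hy]
  push_cast
  linear_combination q2 + (1 + r2 * Complex.I) * q1

/-- For any `φ, α` with `π/6 < φ < 2π/3` and `α = φ − π/6` there is a
3-special polygon with angle parameters `φ` and `α`, and any other 3-special
polygon with the same angle parameters is directly similar to it (an
orientation-preserving similarity of the plane `z ↦ s·z + t`, `s ≠ 0`, carries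
corresponding vertices to each other). -/
theorem three_special_exists_unique (φ α : ℝ)
    (hφ₀ : π / 6 < φ) (hφ₁ : φ < 2 * π / 3) (hα : α = φ - π / 6) :
    ∃ a c' e' e'' c'' : ℂ, Is3Special a c' e' e'' c'' ∧
      EuclideanGeometry.angle c' a e' = φ ∧ EuclideanGeometry.angle a e' e'' = α ∧
      ∀ a₁ c₁' e₁' e₁'' c₁'' : ℂ, Is3Special a₁ c₁' e₁' e₁'' c₁'' →
        EuclideanGeometry.angle c₁' a₁ e₁' = φ → EuclideanGeometry.angle a₁ e₁' e₁'' = α →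
        ∃ s t : ℂ, s ≠ 0 ∧ a₁ = s * a + t ∧ c₁' = s * c' + t ∧ e₁' = s * e' + t ∧
          e₁'' = s * e'' + t ∧ c₁'' = s * c'' + t := by
  have hpi := Real.pi_pos
  have hs : 0 < √3 := by positivity
  have hs2 : √3 * √3 = 3 := Real.mul_self_sqrt (by norm_num)
  obtain ⟨S, hS⟩ : ∃ S, S = Real.sin φ / 2 + √3 / 2 * Real.cos φ := ⟨_, rfl⟩
  have hS1 : Real.sin (φ + π / 3) = S := by
    rw [Real.sin_add, Real.cos_pi_div_three, Real.sin_pi_div_three, hS]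
    ring
  have hS2 : Real.cos (φ - π / 6) = S := by
    rw [Real.cos_sub, Real.cos_pi_div_six, Real.sin_pi_div_six, hS]
    ring
  have hS3 : Real.sin (φ - π / 6) = √3 / 2 * Real.sin φ - Real.cos φ / 2 := by
    rw [Real.sin_sub, Real.cos_pi_div_six, Real.sin_pi_div_six]
    ring
  have hSpos : 0 < S := by
    rw [← hS1]
    exact Real.sin_pos_of_pos_of_lt_pi (by linarith) (by linarith)
  have hT : 0 < √3 / 2 * Real.sin φ - Real.cos φ / 2 := by
    rw [← hS3]
    exact Real.sin_pos_of_pos_of_lt_pi (by linarith) (by linarith)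
  obtain ⟨k, hkdef⟩ : ∃ k, k = 2 * Real.sin φ / S := ⟨_, rfl⟩
  have hkS : k * S = 2 * Real.sin φ := by
    rw [hkdef]
    field_simp
  have hk : 1 < k := by
    rw [hkdef, lt_div_iff₀ hSpos]
    nlinarith
  refine ⟨⟨0, 0⟩, ⟨-√3, 1⟩, ⟨-√3, 1 - k⟩, ⟨√3, 1 - k⟩, ⟨√3, 1⟩, model_special hk, ?_, ?_, ?_⟩
  · rw [EuclideanGeometry.angle, InnerProductGeometry.angle_comm]
    apply angle_of (ρ := √3 / 2 / S) (by positivity) (by linarith) (by linarith)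
    · intro h
      have := congrArg Complex.im h
      simp at this
    · rw [mul_assoc]
      apply Complex.ext
      · rw [Complex.re_ofReal_mul]
        simp [unitC]
        field_simp
        linear_combination (-2) * hS
      · rw [Complex.im_ofReal_mul]
        simp [unitC]
        field_simp
        linear_combination (2 : ℝ) * hS - 2 * hkS + (Real.sin φ) * hs2
  · rw [EuclideanGeometry.angle, hα]
    apply angle_of (ρ := 1 / (2 * S)) (by positivity) (by linarith) (by linarith)
    · intro h
      have := congrArg Complex.re h
      simp at this
    · rw [mul_assoc]
      apply Complex.ext
      · rw [Complex.re_ofReal_mul]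
        simp [unitC, hS2]
        field_simp
        try ring
      · rw [Complex.im_ofReal_mul]
        simp [unitC, hS3]
        field_simp
        linear_combination 4 * hkS - 4 * hS - 2 * (Real.sin φ) * hs2
  · intro a c' e' e'' c'' h hφ _
    obtain ⟨hu, ρ, hρ, he', he'', hc''⟩ := special_shape h
    have hang : ρ * S = Real.sin φ := by
      have h1 : InnerProductGeometry.angle (c' - a)
          ((1 + ρ * unitC (2 * π / 3)) * (c' - a)) = φ := by
        rw [← hφ, EuclideanGeometry.angle, vsub_eq_sub, vsub_eq_sub, he', add_sub_cancel_left]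
      have h2 := angle_inv hu (by
        simp [unitC, sin_two_pi_div_three']
        positivity) h1
      simp [unitC, sin_two_pi_div_three', cos_two_pi_div_three'] at h2
      rw [hS]
      linear_combination -h2
    have hρk : k = 2 * ρ := by
      apply mul_right_cancel₀ hSpos.ne'
      linarith
    have hw : (⟨-√3, 1⟩ : ℂ) ≠ 0 := by
      intro h
      have := congrArg Complex.im h
      simp at this
    have hW : unitC (2 * π / 3) * ⟨-√3, 1⟩ = ⟨0, -2⟩ := by
      apply Complex.ext <;>
        simp [unitC, sin_two_pi_div_three', cos_two_pi_div_three'] <;> nlinarith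
    have hV : unitC (π / 3) * ⟨-√3, 1⟩ = ⟨-√3, -1⟩ := by
      apply Complex.ext <;> simp [unitC] <;> nlinarith
    obtain ⟨m, hm⟩ : ∃ m : ℂ, c' - a = m * ⟨-√3, 1⟩ :=
      ⟨(c' - a) / ⟨-√3, 1⟩, by field_simp⟩
    have hm0 : m ≠ 0 := by
      rintro rfl
      simp at hm
      exact hu hm
    have f1 : (⟨-√3, 1 - k⟩ : ℂ) = ⟨-√3, 1⟩ + ρ * ⟨0, -2⟩ := by
      apply Complex.ext <;> simp
      linarith
    have f2 : (⟨√3, 1 - k⟩ : ℂ) = ⟨-√3, 1⟩ + ρ * ⟨0, -2⟩ + √3 * Complex.I * ⟨0, -2⟩ := by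
      apply Complex.ext <;> simp <;> linarith
    have f3 : (⟨√3, 1⟩ : ℂ) = - ⟨-√3, -1⟩ := by
      apply Complex.ext <;> simp
    have f0 : (⟨0, 0⟩ : ℂ) = 0 := rfl
    refine ⟨m, a, hm0, ?_, ?_, ?_, ?_, ?_⟩
    · rw [f0]
      ring
    · linear_combination hm
    · rw [he', f1, hm, ← hW]
      ring
    · rw [he'', f2, hm, ← hW]
      ring
    · rw [hc'', f3, hm, ← hV]
      ring
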